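/- arXiv:1312.4295 — 2 statements merged into one kernel-verified Lean document; each statement's English description precedes it below -/
import Mathlib

section
/- Let f∈C_c¹(ℝ), i.e. a continuously differentiable function with compact support. Then |f − P_ε * f|_{L_w} → 0 as ε↓0. -/
open MeasureTheory Filter Topology

noncomputable section

namespace DysonMeso

/-- `C` is an upper bound for the weighted Lipschitz quotients of `f`, i.e.
`√(1+x²)√(1+y²)|f(x)-f(y)|/|x-y| ≤ C` for all `x ≠ y`. (`|f|_{L_w} ≤ C`.) -/
def wLipBound (f : ℝ → ℝ) (C : ℝ) : Prop :=
  ∀ x y : ℝ, x ≠ y →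
    Real.sqrt (1 + x ^ 2) * Real.sqrt (1 + y ^ 2) * |f x - f y| ≤ C * |x - y|

/-- The Poisson smoothing `(P_ε * f)(x) = ∫ f(y) (1/π) ε/((x-y)² + ε²) dy`. -/
def poisson (t : ℝ) (f : ℝ → ℝ) (x : ℝ) : ℝ :=
  ∫ y : ℝ, f y * ((1 / Real.pi) * (t / ((x - y) ^ 2 + t ^ 2)))

/-- The Poisson kernel `P_t(z) = (1/π) t/(z² + t²)`. -/
def poissonKernel (t z : ℝ) : ℝ :=
  (1 / Real.pi) * (t / (z ^ 2 + t ^ 2))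

theorem poissonKernel_nonneg {t : ℝ} (ht : 0 < t) (z : ℝ) : 0 ≤ poissonKernel t z := by
  unfold poissonKernel; positivity

theorem continuous_poissonKernel {t : ℝ} (ht : 0 < t) : Continuous (poissonKernel t) := by
  unfold poissonKernel
  exact continuous_const.mul
    (continuous_const.div (by fun_prop) fun z => by positivity)

theorem poissonKernel_sub_eq_cauchyPDFReal {t : ℝ} (ht : 0 < t) (x : ℝ) :
    (fun y => poissonKernel t (x - y)) = ProbabilityTheory.cauchyPDFReal x (NNReal.mk t ht.le) := by
  funext y
  rw [ProbabilityTheory.cauchyPDFReal_def, poissonKernel, NNReal.coe_mk, sub_sq_comm x y,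
    one_div, div_eq_mul_inv, mul_assoc]

theorem integrable_poissonKernel_sub {t : ℝ} (ht : 0 < t) (x : ℝ) :
    Integrable fun y => poissonKernel t (x - y) := by
  rw [poissonKernel_sub_eq_cauchyPDFReal ht]
  exact ProbabilityTheory.integrable_cauchyPDFReal x

theorem integral_poissonKernel_sub {t : ℝ} (ht : 0 < t) (x : ℝ) :
    ∫ y, poissonKernel t (x - y) = 1 := by
  rw [poissonKernel_sub_eq_cauchyPDFReal ht]
  exact ProbabilityTheory.integral_cauchyPDFReal_eq_one x
    fun h => ht.ne' (congrArg NNReal.toReal h)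

/-- Away from the origin `P_t` is dominated by a multiple of `t P_1`. -/
theorem poissonKernel_le_of_le_abs {t r z : ℝ} (ht : 0 < t) (hr : 0 < r) (hz : r ≤ |z|) :
    poissonKernel t z ≤ t * (1 + 1 / r ^ 2) * poissonKernel 1 z := by
  have hz2 : r ^ 2 ≤ z ^ 2 := by
    rw [← sq_abs z]; gcongr
  have hz0 : 0 < z ^ 2 := lt_of_lt_of_le (by positivity) hz2
  have key : t / (z ^ 2 + t ^ 2) ≤ t * (1 + 1 / r ^ 2) * (1 / (z ^ 2 + 1 ^ 2)) := by
    calc t / (z ^ 2 + t ^ 2) ≤ t / z ^ 2 := by gcongr; nlinarith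
      _ = t * (1 + 1 / z ^ 2) * (1 / (z ^ 2 + 1 ^ 2)) := by
          rw [one_add_div hz0.ne', one_pow]
          field_simp
      _ ≤ _ := by gcongr
  unfold poissonKernel
  calc _ ≤ (1 / Real.pi) * (t * (1 + 1 / r ^ 2) * (1 / (z ^ 2 + 1 ^ 2))) := by gcongr
    _ = _ := by ring

/-- Off the (doubled) support, `P_t * f` is `O(t / (1 + x²))`. -/
theorem one_add_sq_mul_abs_poisson_le {f : ℝ → ℝ} (hf : Integrable f) {R : ℝ} (hR : 1 ≤ R)
    (hfR : ∀ y, R ≤ |y| → f y = 0) {t : ℝ} (ht : 0 < t) {x : ℝ} (hx : 2 * R ≤ |x|) :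
    (1 + x ^ 2) * |poisson t f x| ≤ 8 * t * ∫ y, |f y| := by
  have hx1 : 1 ≤ x ^ 2 := by rw [← sq_abs]; nlinarith
  have hpt : ∀ y, ‖(1 + x ^ 2) * (f y * poissonKernel t (x - y))‖ ≤ 8 * t * |f y| := by
    intro y
    by_cases hy : R ≤ |y|
    · simp [hfR y hy]
    have hxy : |x| / 2 ≤ |x - y| := by
      have := abs_sub_abs_le_abs_sub x y
      linarith
    have hsq : x ^ 2 / 4 ≤ (x - y) ^ 2 := by
      rw [← sq_abs x, ← sq_abs (x - y)]
      nlinarith [abs_nonneg x]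
    have hk : (1 + x ^ 2) * poissonKernel t (x - y) ≤ 8 * t := by
      have hpi : 1 / Real.pi ≤ 1 := by
        rw [div_le_one Real.pi_pos]; linarith [Real.pi_gt_three]
      have h1 : poissonKernel t (x - y) ≤ t / (x ^ 2 / 4) := by
        unfold poissonKernel
        calc _ ≤ 1 * (t / (x ^ 2 / 4)) := by
              gcongr
              nlinarith
          _ = _ := one_mul _
      calc _ ≤ (2 * x ^ 2) * (t / (x ^ 2 / 4)) := by
            gcongr
            · exact poissonKernel_nonneg ht _
            · linarith
        _ = 8 * t := by
            have : x ≠ 0 := by rintro rfl; norm_num at hx1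
            field_simp
            norm_num
    rw [Real.norm_eq_abs, mul_left_comm, abs_mul,
      abs_of_nonneg (mul_nonneg (by positivity) (poissonKernel_nonneg ht _)), mul_comm]
    gcongr
  have := norm_integral_le_of_norm_le (hf.abs.const_mul (8 * t)) (ae_of_all _ hpt)
  rw [integral_const_mul, integral_const_mul, norm_mul, Real.norm_eq_abs, Real.norm_eq_abs,
    abs_of_pos (by positivity : 0 < 1 + x ^ 2)] at this
  exact this

/-- Quantitative approximation by Poisson smoothing for a bounded function with a modulus of
continuity. -/
theorem abs_sub_poisson_le {g : ℝ → ℝ} (hg : Integrable g) {M δ r t : ℝ}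
    (hM : ∀ y, |g y| ≤ M) (hδ : 0 < δ) (hr : 0 < r)
    (hmod : ∀ x y, |x - y| < r → |g x - g y| < δ) (ht : 0 < t) (x : ℝ) :
    |g x - poisson t g x| ≤ δ + 2 * M * (t * (1 + 1 / r ^ 2)) := by
  have hM0 : 0 ≤ M := (abs_nonneg _).trans (hM 0)
  have hK := integrable_poissonKernel_sub ht x
  have hK1 := integrable_poissonKernel_sub one_pos x
  have hgK : Integrable fun y => g y * poissonKernel t (x - y) :=
    hK.bdd_mul hg.aestronglyMeasurable (ae_of_all _ hM)
  have heq : g x - poisson t g x = ∫ y, (g x - g y) * poissonKernel t (x - y) := by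
    simp_rw [sub_mul]
    rw [integral_sub (hK.const_mul _) hgK, integral_const_mul, integral_poissonKernel_sub ht,
      mul_one]
    rfl
  have hpt : ∀ y, ‖(g x - g y) * poissonKernel t (x - y)‖ ≤
      δ * poissonKernel t (x - y)
        + 2 * M * (t * (1 + 1 / r ^ 2)) * poissonKernel 1 (x - y) := by
    intro y
    have h0 := poissonKernel_nonneg ht (x - y)
    have h1 := poissonKernel_nonneg one_pos (x - y)
    rw [Real.norm_eq_abs, abs_mul, abs_of_nonneg h0]
    rcases lt_or_ge |x - y| r with h | h
    · have := mul_le_mul_of_nonneg_right (hmod x y h).le h0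
      have : 0 ≤ 2 * M * (t * (1 + 1 / r ^ 2)) * poissonKernel 1 (x - y) := by positivity
      linarith
    · have h2 : |g x - g y| ≤ 2 * M := by
        linarith [abs_sub (g x) (g y), hM x, hM y]
      have h3 := mul_le_mul h2 (poissonKernel_le_of_le_abs ht hr h) h0 (by positivity)
      have : 0 ≤ δ * poissonKernel t (x - y) := by positivity
      linarith
  rw [heq, ← Real.norm_eq_abs]
  refine (norm_integral_le_of_norm_le ((hK.const_mul δ).add (hK1.const_mul _))
    (ae_of_all _ hpt)).trans_eq ?_
  simp only [Pi.add_apply]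
  rw [integral_add (hK.const_mul δ) (hK1.const_mul _), integral_const_mul, integral_const_mul,
    integral_poissonKernel_sub ht, integral_poissonKernel_sub one_pos, mul_one, mul_one]

theorem hasDerivAt_poisson {f : ℝ → ℝ} (hf : ContDiff ℝ 1 f) (hsupp : HasCompactSupport f)
    {t : ℝ} (ht : 0 < t) (x : ℝ) :
    HasDerivAt (poisson t f) (poisson t (deriv f) x) x :=
  hsupp.hasDerivAt_convolution_left (ContinuousLinearMap.lsmul ℝ ℝ) hf
    (continuous_poissonKernel ht).locallyIntegrable x

theorem sin_arctan_sub_arctan (x y : ℝ) :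
    √(1 + x ^ 2) * √(1 + y ^ 2) * Real.sin (Real.arctan x - Real.arctan y) = x - y := by
  have hx : √(1 + x ^ 2) ≠ 0 := by positivity
  have hy : √(1 + y ^ 2) ≠ 0 := by positivity
  rw [Real.sin_sub, Real.sin_arctan, Real.sin_arctan, Real.cos_arctan, Real.cos_arctan]
  field_simp

/-- If `h' ≤ C / (1 + x²)`, then `C arctan - h` is monotone. -/
theorem monotone_mul_arctan_sub {h : ℝ → ℝ} {C : ℝ} (hd : Differentiable ℝ h)
    (hC : ∀ x, (1 + x ^ 2) * deriv h x ≤ C) :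
    Monotone fun x => C * Real.arctan x - h x := by
  have hD : ∀ x, HasDerivAt (fun x => C * Real.arctan x - h x)
      (C * (1 / (1 + x ^ 2)) - deriv h x) x := fun x =>
    ((Real.hasDerivAt_arctan x).const_mul C).sub (hd x).hasDerivAt
  refine monotone_of_deriv_nonneg (fun x => (hD x).differentiableAt) fun x => ?_
  have hx : 0 < 1 + x ^ 2 := by positivity
  rw [(hD x).deriv, sub_nonneg, mul_one_div, le_div_iff₀ hx, mul_comm]
  exact hC x

/-- A function vanishing at infinity with `(1 + x²) |h'| ≤ C` satisfies a weighted one-sided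
Lipschitz bound with constant `(π / 2) C`. -/
theorem mul_sub_le_of_deriv_le {h : ℝ → ℝ} {C : ℝ} (hC0 : 0 ≤ C) (hd : Differentiable ℝ h)
    (hC : ∀ x, (1 + x ^ 2) * |deriv h x| ≤ C) (htop : Tendsto h atTop (𝓝 0))
    (hbot : Tendsto h atBot (𝓝 0)) {x y : ℝ} (hxy : y < x) :
    √(1 + x ^ 2) * √(1 + y ^ 2) * (h x - h y) ≤ Real.pi / 2 * C * (x - y) := by
  have hu := monotone_mul_arctan_sub hd fun x =>
    (mul_le_mul_of_nonneg_left (le_abs_self (deriv h x)) (by positivity)).trans (hC x)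
  have hv : Monotone fun x => C * Real.arctan x - -h x :=
    monotone_mul_arctan_sub (h := fun x => -h x) hd.neg fun x => by
      rw [deriv.fun_neg]
      exact (mul_le_mul_of_nonneg_left (neg_le_abs (deriv h x)) (by positivity)).trans (hC x)
  have hT := Real.tendsto_arctan_atTop.mono_right nhdsWithin_le_nhds
  have hB := Real.tendsto_arctan_atBot.mono_right nhdsWithin_le_nhds
  have hvT := hv.ge_of_tendsto ((hT.const_mul C).sub htop.neg) x
  have hvB := hv.le_of_tendsto ((hB.const_mul C).sub hbot.neg) y
  have hu1 := hu hxy.le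
  simp only at hu1 hvT hvB
  set d := Real.arctan x - Real.arctan y with hdef
  have hd0 : 0 < d := sub_pos.2 (Real.arctan_strictMono hxy)
  have hdpi : d < Real.pi := by
    linarith [Real.arctan_lt_pi_div_two x, Real.neg_pi_div_two_lt_arctan y]
  have hle1 : h x - h y ≤ C * d := by rw [hdef]; linarith
  have hle2 : h x - h y ≤ C * (Real.pi - d) := by rw [hdef]; linarith
  have hpi := Real.pi_pos
  have hJ : ∀ s, 0 ≤ s → s ≤ Real.pi / 2 → s ≤ Real.pi / 2 * Real.sin s := fun s h0 h1 => by
    have h2 := mul_le_mul_of_nonneg_left (Real.mul_le_sin h0 h1) (half_pos hpi).le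
    rwa [← mul_assoc, div_mul_div_cancel₀' hpi.ne', div_self two_ne_zero, one_mul] at h2
  have hsin : h x - h y ≤ C * (Real.pi / 2 * Real.sin d) := by
    rcases le_total d (Real.pi / 2) with h | h
    · exact hle1.trans (mul_le_mul_of_nonneg_left (hJ d hd0.le h) hC0)
    · have := hJ (Real.pi - d) (by linarith) (by linarith)
      rw [Real.sin_pi_sub] at this
      exact hle2.trans (mul_le_mul_of_nonneg_left this hC0)
  calc _ ≤ √(1 + x ^ 2) * √(1 + y ^ 2) * (C * (Real.pi / 2 * Real.sin d)) := by gcongr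
    _ = Real.pi / 2 * C * (√(1 + x ^ 2) * √(1 + y ^ 2) * Real.sin d) := by ring
    _ = _ := by rw [hdef, sin_arctan_sub_arctan]

theorem wLipBound_of_deriv_le {h : ℝ → ℝ} {C : ℝ} (hC0 : 0 ≤ C) (hd : Differentiable ℝ h)
    (hC : ∀ x, (1 + x ^ 2) * |deriv h x| ≤ C) (htop : Tendsto h atTop (𝓝 0))
    (hbot : Tendsto h atBot (𝓝 0)) : wLipBound h (Real.pi / 2 * C) := by
  have key : ∀ x y, y < x →
      √(1 + x ^ 2) * √(1 + y ^ 2) * |h x - h y| ≤ Real.pi / 2 * C * |x - y| := by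
    intro x y hxy
    have h1 := mul_sub_le_of_deriv_le hC0 hd hC htop hbot hxy
    have h2 := mul_sub_le_of_deriv_le (h := fun x => -h x) hC0 hd.neg
      (fun x => by rw [deriv.fun_neg, abs_neg]; exact hC x)
      (by simpa using htop.neg) (by simpa using hbot.neg) hxy
    rw [abs_of_pos (sub_pos.2 hxy)]
    rcases abs_cases (h x - h y) with ⟨h3, -⟩ | ⟨h3, -⟩ <;> rw [h3]
    · exact h1
    · convert h2 using 2
      ring
  intro x y hne
  rcases hne.lt_or_gt with hlt | hlt
  · rw [abs_sub_comm, abs_sub_comm x y, mul_comm √(1 + x ^ 2)]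
    exact key y x hlt
  · exact key x y hlt

/-- The Poisson smoothing error of an integrable, compactly supported function vanishes at
infinity. -/
theorem tendsto_sub_poisson_cocompact {f : ℝ → ℝ} (hf : Integrable f) {R : ℝ} (hR : 1 ≤ R)
    (hfR : ∀ y, R ≤ |y| → f y = 0) {t : ℝ} (ht : 0 < t) :
    Tendsto (fun x => f x - poisson t f x) (cocompact ℝ) (𝓝 0) := by
  have hlim : Tendsto (fun x : ℝ => 8 * t * (∫ y, |f y|) * ‖x‖⁻¹) (cocompact ℝ) (𝓝 0) := by
    simpa using (tendsto_inv_atTop_zero.comp (tendsto_norm_cocompact_atTop (E := ℝ))).const_mul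
      (8 * t * ∫ y, |f y|)
  refine squeeze_zero_norm' ?_ hlim
  filter_upwards [(tendsto_norm_cocompact_atTop (E := ℝ)).eventually_ge_atTop (2 * R)] with x hx
  rw [Real.norm_eq_abs] at hx ⊢
  have hx0 : 0 < |x| := by linarith
  rw [hfR x (by linarith), zero_sub, abs_neg, Real.norm_eq_abs, ← div_eq_mul_inv,
    le_div_iff₀ hx0, mul_comm]
  refine le_trans ?_ (one_add_sq_mul_abs_poisson_le hf hR hfR ht hx)
  gcongr
  rw [← sq_abs]
  nlinarith

/-- The Poisson smoothing of a continuous compactly supported function converges uniformly with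
weight `1 + x²`. -/
theorem eventually_one_add_sq_mul_abs_sub_poisson_le {g : ℝ → ℝ} (hg : Continuous g)
    (hsupp : HasCompactSupport g) {η : ℝ} (hη : 0 < η) :
    ∀ᶠ t in 𝓝[>] (0 : ℝ), ∀ x, (1 + x ^ 2) * |g x - poisson t g x| ≤ η := by
  obtain ⟨R₀, -, hR₀⟩ := hsupp.exists_pos_le_norm
  obtain ⟨M, hM⟩ := hg.bounded_above_of_compact_support hsupp
  have hgi := hg.integrable_of_hasCompactSupport (μ := volume) hsupp
  set R := max R₀ 1
  set A := 1 + (2 * R) ^ 2 with hA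
  have hA0 : 0 < A := by positivity
  set δ := η / (2 * A)
  have hδ : 0 < δ := by positivity
  obtain ⟨r, hr, hmod⟩ := Metric.uniformContinuous_iff.1
    (hsupp.uniformContinuous_of_continuous hg) δ hδ
  have hsmall : ∀ B c : ℝ, 0 < c → ∀ᶠ t in 𝓝[>] (0 : ℝ), t * B < c := fun B c hc => by
    have : Tendsto (fun t : ℝ => t * B) (𝓝[>] 0) (𝓝 0) := by
      have h : Tendsto (fun t : ℝ => t * B) (𝓝 0) (𝓝 (0 * B)) := tendsto_id.mul_const B
      rw [zero_mul] at h
      exact h.mono_left nhdsWithin_le_nhds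
    exact this.eventually_lt_const hc
  filter_upwards [hsmall (8 * ∫ y, |g y|) η hη, hsmall (2 * M * (1 + 1 / r ^ 2)) δ hδ,
    self_mem_nhdsWithin] with t ht1 ht2 ht x
  rw [Set.mem_Ioi] at ht
  have hgR : ∀ y, R ≤ |y| → g y = 0 := fun y hy => hR₀ y ((le_max_left _ _).trans hy)
  rcases le_total (2 * R) |x| with hx | hx
  · have hR1 : 1 ≤ R := le_max_right _ _
    rw [hgR x (by linarith), zero_sub, abs_neg]
    linarith [one_add_sq_mul_abs_poisson_le hgi hR1 hgR ht hx]
  · have h1 := abs_sub_poisson_le hgi hM hδ hr (fun x y h => hmod h) ht x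
    have h2 : 1 + x ^ 2 ≤ A := by rw [hA, ← sq_abs x]; gcongr
    calc (1 + x ^ 2) * |g x - poisson t g x| ≤ A * (2 * δ) := by
          gcongr
          linarith
      _ = η := by simp only [δ]; field_simp

/-- Lemma 4.3: for `f ∈ C_c¹(ℝ)`, `|f - P_ε * f|_{L_w} → 0` as `ε ↓ 0`: for every `η > 0`,
eventually (as `ε ↓ 0`) the weighted Lipschitz seminorm of `f - P_ε * f` is at most `η`. -/
theorem poisson_approx_Lw (f : ℝ → ℝ) (hf : ContDiff ℝ 1 f) (hsupp : HasCompactSupport f) :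
    ∀ η > (0 : ℝ), ∀ᶠ ε in 𝓝[>] (0 : ℝ),
      wLipBound (fun x => f x - poisson ε f x) η := by
  intro η hη
  obtain ⟨R₀, -, hR₀⟩ := hsupp.exists_pos_le_norm
  have hfR : ∀ y, max R₀ 1 ≤ |y| → f y = 0 := fun y hy => hR₀ y ((le_max_left _ _).trans hy)
  have hfi := hf.continuous.integrable_of_hasCompactSupport (μ := volume) hsupp
  have hC : 0 < η / (Real.pi / 2) := by positivity
  filter_upwards [eventually_one_add_sq_mul_abs_sub_poisson_le (hf.continuous_deriv le_rfl)
    hsupp.deriv hC, self_mem_nhdsWithin] with ε hε hε0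
  have hD : ∀ x, HasDerivAt (fun x => f x - poisson ε f x)
      (deriv f x - poisson ε (deriv f) x) x := fun x =>
    (hf.differentiable one_ne_zero x).hasDerivAt.sub (hasDerivAt_poisson hf hsupp hε0 x)
  have hlim := tendsto_sub_poisson_cocompact hfi (le_max_right R₀ 1) hfR hε0
  rw [← mul_div_cancel₀ η (half_pos Real.pi_pos).ne']
  exact wLipBound_of_deriv_le hC.le (fun x => (hD x).differentiableAt)
    (fun x => by rw [(hD x).deriv]; exact hε x)
    (hlim.mono_left atTop_le_cocompact) (hlim.mono_left atBot_le_cocompact)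

end DysonMeso
end
end

section
/- Let ξ be a random variable distributed according to the semicircle law. Then for every w∈ℂ∖ℝ: Var(Im(1/(w−ξ))) ≤ (√2/2)/|Im w| and Var(Re(1/(w−ξ))) ≤ (√2/2)/|Im w|. -/
open MeasureTheory ProbabilityTheory Filter Topology

noncomputable section

namespace DysonMeso

/-- The semicircle law: the probability measure on `[-√2, √2]` with density `(1/π)√(2-x²)`. -/
def semicircle : Measure ℝ :=
  volume.withDensity fun x => ENNReal.ofReal (Real.sqrt (2 - x ^ 2) / Real.pi)

theorem support_sqrt_one_sub_sq_subset :
    Function.support (fun x : ℝ => Real.sqrt (1 - x ^ 2)) ⊆ Set.Ioc (-1) 1 := by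
  intro x hx
  have h : 0 < 1 - x ^ 2 := by
    by_contra hn
    exact hx (Real.sqrt_eq_zero_of_nonpos (not_lt.mp hn))
  exact ⟨by nlinarith, by nlinarith⟩

theorem sqrt_two_sub_sq_eq (x : ℝ) :
    Real.sqrt (2 - x ^ 2) = Real.sqrt 2 * Real.sqrt (1 - ((Real.sqrt 2)⁻¹ * x) ^ 2) := by
  rw [← Real.sqrt_mul (by norm_num), mul_pow, inv_pow, Real.sq_sqrt (by norm_num)]
  congr 1
  ring

theorem integrable_sqrt_two_sub_sq : Integrable fun x : ℝ => Real.sqrt (2 - x ^ 2) := by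
  have h : Integrable fun x : ℝ => Real.sqrt (1 - x ^ 2) := by
    refine (integrableOn_iff_integrable_of_support_subset
      support_sqrt_one_sub_sq_subset).mp ?_
    exact ((by fun_prop : Continuous fun x : ℝ => Real.sqrt (1 - x ^ 2)).integrableOn_Icc).mono_set
      Set.Ioc_subset_Icc_self
  simp_rw [sqrt_two_sub_sq_eq]
  exact (h.comp_mul_left' (R := (Real.sqrt 2)⁻¹) (by positivity)).const_mul _

theorem integral_sqrt_two_sub_sq : ∫ x : ℝ, Real.sqrt (2 - x ^ 2) = Real.pi := by
  simp_rw [sqrt_two_sub_sq_eq]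
  rw [integral_const_mul,
    Measure.integral_comp_inv_mul_left (fun x => Real.sqrt (1 - x ^ 2)),
    ← intervalIntegral.integral_eq_integral_of_support_subset support_sqrt_one_sub_sq_subset,
    integral_sqrt_one_sub_sq, abs_of_nonneg (Real.sqrt_nonneg 2), smul_eq_mul, ← mul_assoc,
    Real.mul_self_sqrt (by norm_num)]
  ring

instance isProbabilityMeasure_semicircle : IsProbabilityMeasure semicircle := by
  constructor
  rw [semicircle, withDensity_apply _ MeasurableSet.univ, Measure.restrict_univ,
    ← ofReal_integral_eq_lintegral_ofReal (integrable_sqrt_two_sub_sq.div_const _)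
      (Eventually.of_forall fun x => by positivity),
    integral_div, integral_sqrt_two_sub_sq, div_self Real.pi_ne_zero, ENNReal.ofReal_one]

theorem integral_semicircle_le {g : ℝ → ℝ} (hg : Integrable g) (h0 : ∀ x, 0 ≤ g x) :
    ∫ x, g x ∂semicircle ≤ Real.sqrt 2 / Real.pi * ∫ x, g x := by
  rw [semicircle, integral_withDensity_eq_integral_toReal_smul (by fun_prop)
    (Eventually.of_forall fun x => ENNReal.ofReal_lt_top), ← integral_const_mul]
  refine integral_mono_of_nonneg
    (Eventually.of_forall fun x => mul_nonneg ENNReal.toReal_nonneg (h0 x)) (hg.const_mul _)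
    (Eventually.of_forall fun x => ?_)
  dsimp only
  rw [smul_eq_mul, ENNReal.toReal_ofReal (by positivity)]
  have := h0 x
  gcongr
  nlinarith [sq_nonneg x]

/-- Interpolates between `x² / (x² + c²)²` at `s = -1` and `c² / (x² + c²)²` at `s = 1`. -/
def resolventSq (s c x : ℝ) : ℝ :=
  ((1 + s) * c ^ 2 + (1 - s) * x ^ 2) / 2 / (x ^ 2 + c ^ 2) ^ 2

theorem resolventSq_nonneg {s : ℝ} (hs : |s| ≤ 1) (c x : ℝ) : 0 ≤ resolventSq s c x := by
  have h := abs_le.mp hs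
  have h1 : 0 ≤ 1 + s := by linarith
  have h2 : 0 ≤ 1 - s := by linarith
  unfold resolventSq
  positivity

theorem integrable_resolventSq {s c : ℝ} (hs : |s| ≤ 1) (hc : 0 < c) :
    Integrable (resolventSq s c) := by
  have h : Integrable fun x : ℝ => (c ^ 2)⁻¹ * (1 + (c⁻¹ * x) ^ 2)⁻¹ :=
    (integrable_inv_one_add_sq.comp_mul_left' (inv_ne_zero hc.ne')).const_mul _
  refine h.mono' (Measurable.aestronglyMeasurable (by unfold resolventSq; fun_prop))
    (Eventually.of_forall fun x => ?_)
  rw [Real.norm_of_nonneg (resolventSq_nonneg hs c x)]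
  have h2 : (c ^ 2)⁻¹ * (1 + (c⁻¹ * x) ^ 2)⁻¹ = (x ^ 2 + c ^ 2) / (x ^ 2 + c ^ 2) ^ 2 := by
    field_simp
    ring
  rw [h2, resolventSq]
  gcongr
  have h := abs_le.mp hs
  nlinarith [mul_nonneg (by linarith : 0 ≤ 1 - s) (sq_nonneg c),
    mul_nonneg (by linarith : 0 ≤ 1 + s) (sq_nonneg x)]

theorem hasDerivAt_resolventSq (s : ℝ) {c : ℝ} (hc : 0 < c) (x : ℝ) :
    HasDerivAt (fun x => (Real.arctan (c⁻¹ * x) * c⁻¹ + s * (x / (x ^ 2 + c ^ 2))) / 2)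
      (resolventSq s c x) x := by
  have hx : x ^ 2 + c ^ 2 ≠ 0 := by positivity
  have h1 : HasDerivAt (fun x => c⁻¹ * x) c⁻¹ x := by
    simpa using (hasDerivAt_id x).const_mul c⁻¹
  have h2 : HasDerivAt (fun x : ℝ => x ^ 2 + c ^ 2) (2 * x) x := by
    simpa using (hasDerivAt_pow 2 x).add_const (c ^ 2)
  refine (((h1.arctan.mul_const c⁻¹).add
    (((hasDerivAt_id x).div h2 hx).const_mul s)).div_const 2).congr_deriv ?_
  have h3 : 1 + (c⁻¹ * x) ^ 2 ≠ 0 := by positivity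
  have h4 : c ^ 2 + x ^ 2 ≠ 0 := by positivity
  simp only [resolventSq, id]
  field_simp
  ring

theorem tendsto_div_sq_add_sq (c : ℝ) {l : Filter ℝ}
    (hl : Tendsto (fun x : ℝ => x⁻¹) l (𝓝 0)) :
    Tendsto (fun x : ℝ => x / (x ^ 2 + c ^ 2)) l (𝓝 0) := by
  refine squeeze_zero_norm (fun x => ?_) (by simpa using hl.norm)
  rcases eq_or_ne x 0 with rfl | hx
  · simp
  · have : 0 < |x| := abs_pos.mpr hx
    rw [norm_div, Real.norm_eq_abs, Real.norm_of_nonneg (by positivity),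
      div_le_iff₀ (by positivity), ← sq_abs x]
    field_simp
    nlinarith [sq_nonneg c]

theorem integral_resolventSq {s c : ℝ} (hs : |s| ≤ 1) (hc : 0 < c) :
    ∫ x, resolventSq s c x = Real.pi / (2 * c) := by
  have hbot := (((((Real.tendsto_arctan_atBot.mono_right nhdsWithin_le_nhds).comp
    (tendsto_id.const_mul_atBot (inv_pos.mpr hc))).mul_const c⁻¹).add
    ((tendsto_div_sq_add_sq c tendsto_inv_atBot_zero).const_mul s)).div_const 2)
  have htop := (((((Real.tendsto_arctan_atTop.mono_right nhdsWithin_le_nhds).comp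
    (tendsto_id.const_mul_atTop (inv_pos.mpr hc))).mul_const c⁻¹).add
    ((tendsto_div_sq_add_sq c tendsto_inv_atTop_zero).const_mul s)).div_const 2)
  rw [integral_of_hasDerivAt_of_tendsto (hasDerivAt_resolventSq s hc)
    (integrable_resolventSq hs hc) hbot htop]
  field_simp
  ring

theorem variance_semicircle_le_of_sq_eq {f : ℝ → ℝ} (hf : Measurable f) {s c a : ℝ}
    (hs : |s| ≤ 1) (hc : 0 < c) (h : ∀ x, f x ^ 2 = resolventSq s c (a - x)) :
    variance f semicircle ≤ Real.sqrt 2 / 2 / c :=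
  calc variance f semicircle
      ≤ ∫ x, (f ^ 2) x ∂semicircle := variance_le_expectation_sq hf.aestronglyMeasurable
    _ = ∫ x, resolventSq s c (a - x) ∂semicircle := by simp only [Pi.pow_apply, h]
    _ ≤ Real.sqrt 2 / Real.pi * ∫ x, resolventSq s c (a - x) :=
        integral_semicircle_le ((integrable_resolventSq hs hc).comp_sub_left a)
          fun x => resolventSq_nonneg hs c _
    _ = Real.sqrt 2 / 2 / c := by
        rw [integral_sub_left_eq_self (resolventSq s c), integral_resolventSq hs hc]
        field_simp

/-- Lemma 8.3: for `ξ` semicircle distributed and `w ∈ ℂ∖ℝ`,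
`Var(Im 1/(w-ξ)) ≤ (√2/2)/|Im w|` and `Var(Re 1/(w-ξ)) ≤ (√2/2)/|Im w|`. -/
theorem semicircle_var_bound (w : ℂ) (hw : w.im ≠ 0) :
    variance (fun x : ℝ => ((w - (x : ℂ))⁻¹).im) semicircle ≤ (Real.sqrt 2 / 2) / |w.im| ∧
    variance (fun x : ℝ => ((w - (x : ℂ))⁻¹).re) semicircle ≤ (Real.sqrt 2 / 2) / |w.im| := by
  have hc : 0 < |w.im| := abs_pos.mpr hw
  constructor
  · refine variance_semicircle_le_of_sq_eq (by fun_prop) (s := 1) (a := w.re) (by simp) hc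
      fun x => ?_
    simp only [resolventSq, Complex.inv_im, Complex.normSq_apply, Complex.sub_re, Complex.sub_im,
      Complex.ofReal_re, Complex.ofReal_im, sq_abs, div_pow]
    ring
  · refine variance_semicircle_le_of_sq_eq (by fun_prop) (s := -1) (a := w.re) (by simp) hc
      fun x => ?_
    simp only [resolventSq, Complex.inv_re, Complex.normSq_apply, Complex.sub_re, Complex.sub_im,
      Complex.ofReal_re, Complex.ofReal_im, sq_abs, div_pow]
    ring

end DysonMeso
end
end
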